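/- Let h ∈ 𝒞, let u₀ ∈ ℝⁿ be a fixed vector, and define φ(u) = (u, u₀) for u ∈ S^{n-1}. Then ∫_{S^{n-1}} φ det(h_ij + h δ_ij) dℋ^{n-1} = 0 and equality holds: ∫_{S^{n-1}} tr(c_ij) φ² dℋ^{n-1} = ∫_{S^{n-1}} Σ_{i,j=1}^{n-1} c_ij φ_i φ_j dℋ^{n-1}, where (c_ij) is the cofactor matrix of (h_ij + h δ_ij). -/

import Mathlib

open MeasureTheory Metric
open scoped RealInnerProductSpace ENNReal

noncomputable section

/-- Euclidean `n`-space. -/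
abbrev E (n : ℕ) : Type := EuclideanSpace ℝ (Fin n)

/-- Orthogonal projection onto the tangent space `u^⊥` of the sphere at a unit vector `u`. -/
noncomputable def tproj {n : ℕ} (u : E n) : E n →L[ℝ] E n :=
  ContinuousLinearMap.id ℝ (E n) - (innerSL ℝ u).smulRight u

/-- The second derivative of `h` at `u` as an endomorphism of `ℝⁿ`.  For a function on the
sphere, identified with its `1`-homogeneous extension, its restriction to the tangent space
`u^⊥` is represented in any orthonormal frame by the matrix `(h_ij + h δ_ij)`. -/
noncomputable def sHess {n : ℕ} (h : E n → ℝ) (u : E n) : E n →L[ℝ] E n :=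
  fderiv ℝ (gradient h) u

/-- `det(h_ij + h δ_ij)(u)`: the determinant of the restriction of `sHess h u` to the
tangent space `u^⊥`. -/
noncomputable def sdet {n : ℕ} (h : E n → ℝ) (u : E n) : ℝ :=
  LinearMap.det
    (((tproj u).comp ((sHess h u).comp (tproj u)) + (innerSL ℝ u).smulRight u :
      E n →L[ℝ] E n) : E n →ₗ[ℝ] E n)

/-- Positive `1`-homogeneity; functions on the sphere are identified with their
`1`-homogeneous extensions. -/
def homog1 {n : ℕ} (h : E n → ℝ) : Prop := ∀ t : ℝ, 0 < t → ∀ x : E n, h (t • x) = t * h x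

/-- `h ∈ 𝒞`: (the `1`-homogeneous extension of) a function of class `C²` on the sphere
such that the matrix `(h_ij + h δ_ij)` is positive definite at every point of the sphere. -/
def memC (n : ℕ) (h : E n → ℝ) : Prop :=
  homog1 h ∧ ContDiffOn ℝ 2 h {(0 : E n)}ᶜ ∧
    ∀ u ∈ sphere (0 : E n) 1, ∀ v ∈ (ℝ ∙ u)ᗮ, v ≠ 0 → 0 < ⟪sHess h u v, v⟫

open Polynomial in
/-- Coefficients of polynomials of bounded degree are fixed linear combinations of the values at
given distinct nodes. -/
lemma exists_coeff_weights {n : ℕ} (v : Fin (n + 1) → ℝ) (hv : Function.Injective v) (k : ℕ) :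
    ∃ w : Fin (n + 1) → ℝ, ∀ p : ℝ[X], p.natDegree ≤ n →
      p.coeff k = ∑ i, w i * p.eval (v i) := by
  refine ⟨fun i => (Lagrange.basis Finset.univ v i).coeff k, fun p hp => ?_⟩
  have hdeg : p.degree < (Finset.univ : Finset (Fin (n + 1))).card := by
    refine lt_of_le_of_lt degree_le_natDegree ?_
    simp only [Finset.card_univ, Fintype.card_fin]
    exact_mod_cast Nat.lt_succ_of_le hp
  have h := Lagrange.eq_interpolate (s := Finset.univ) (v := v) hv.injOn hdeg
  conv_lhs => rw [h, Lagrange.interpolate_apply, finsetSum_coeff]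
  exact Finset.sum_congr rfl fun i _ => by rw [coeff_C_mul, mul_comm]

open Polynomial in
/-- The determinant along an affine line of endomorphisms of `ℝⁿ` is a polynomial of degree at
most `n`. -/
lemma exists_polynomial_det {n : ℕ} (M B : E n →L[ℝ] E n) :
    ∃ p : ℝ[X], p.natDegree ≤ n ∧ (∀ t : ℝ, p.eval t = (M + t • B).det) ∧
      p.coeff n = B.det := by
  let b := (EuclideanSpace.basisFun (Fin n) ℝ).toBasis
  let m := LinearMap.toMatrix b b
  refine ⟨((X : ℝ[X]) • (m B).map C + (m M).map C).det, ?_, fun t => ?_, ?_⟩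
  · simpa using natDegree_det_X_add_C_le (m B) (m M)
  · have h1 : (M + t • B).det = (t • m B + m M).det := by
      rw [ContinuousLinearMap.det, ← LinearMap.det_toMatrix b, add_comm]
      simp [m]
    rw [h1, ← coe_evalRingHom, RingHom.map_det]
    congr 1
    ext i j
    simp
    ring
  · have := coeff_det_X_add_C_card (m B) (m M)
    rw [Fintype.card_fin] at this
    rw [this, ContinuousLinearMap.det]
    exact LinearMap.det_toMatrix b _

open Polynomial in
lemma exists_det_one_add_smul {n : ℕ} (N : E n →L[ℝ] E n) :
    ∃ q : ℝ[X], ∀ t : ℝ, (1 + t • N).det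
      = 1 + LinearMap.trace ℝ (E n) (N : E n →ₗ[ℝ] E n) * t + q.eval t * t ^ 2 := by
  let b := (EuclideanSpace.basisFun (Fin n) ℝ).toBasis
  let m := LinearMap.toMatrix b b
  refine ⟨(1 + (X : ℝ[X]) • (m N).map C).det.divX.divX, fun t => ?_⟩
  have h1 : (1 + t • N).det = (1 + t • m N).det := by
    rw [ContinuousLinearMap.det, ← LinearMap.det_toMatrix b]
    congr 1
    ext i j
    simp [m, LinearMap.toMatrix_one]
  rw [h1, Matrix.det_one_add_smul, LinearMap.trace_eq_matrix_trace ℝ b]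

lemma det_mul_clm {n : ℕ} (M N : E n →L[ℝ] E n) : (M * N).det = M.det * N.det := by
  simp only [ContinuousLinearMap.det]
  exact LinearMap.det_comp _ _

open Polynomial in
/-- The linear coefficient of `t ↦ det (M + t B)` for invertible `M`. -/
lemma coeff_one_of_eval_eq_det {n : ℕ} {M B N : E n →L[ℝ] E n} (hMN : M * N = 1) {p : ℝ[X]}
    (hp : ∀ t : ℝ, p.eval t = (M + t • B).det) :
    p.coeff 1 = M.det * LinearMap.trace ℝ (E n) ((N * B : E n →L[ℝ] E n) : E n →ₗ[ℝ] E n) := by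
  obtain ⟨q, hq⟩ := exists_det_one_add_smul (N * B)
  set c := LinearMap.trace ℝ (E n) ((N * B : E n →L[ℝ] E n) : E n →ₗ[ℝ] E n)
  have : p = C M.det * (1 + C c * X + q * X ^ 2) := by
    refine Polynomial.funext fun t => ?_
    have h1 : M + t • B = M * (1 + t • (N * B)) := by
      ext1 x
      have := congr($hMN (B x))
      simp only [mul_apply_eq_comp, one_apply_eq_self] at this
      simp [this]
    rw [hp, h1, det_mul_clm, hq]
    simp
  rw [this, coeff_C_mul]
  congr 1
  have h2 : (q * X ^ 2).coeff 1 = 0 := by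
    rw [coeff_mul_X_pow']; simp
  simp [coeff_one, h2]

/-- The rank-one operator `x ↦ ⟪u, x⟫ u`. -/
def rankOneSelf {n : ℕ} (u : E n) : E n →L[ℝ] E n := (innerSL ℝ u).smulRight u

lemma rankOneSelf_apply {n : ℕ} (u x : E n) : rankOneSelf u x = ⟪u, x⟫ • u := by
  simp [rankOneSelf]

lemma tproj_eq_one_sub {n : ℕ} (u : E n) : tproj u = 1 - rankOneSelf u := rfl

lemma tproj_apply {n : ℕ} (u x : E n) : tproj u x = x - ⟪u, x⟫ • u := by
  simp [tproj_eq_one_sub, rankOneSelf_apply]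

lemma trace_smulRight_clm {n : ℕ} (f : E n →L[ℝ] ℝ) (x : E n) :
    LinearMap.trace ℝ (E n) ((f.smulRight x : E n →L[ℝ] E n) : E n →ₗ[ℝ] E n) = f x :=
  LinearMap.trace_smulRight (f : E n →ₗ[ℝ] ℝ) x

lemma isUnit_of_det_ne_zero {n : ℕ} {K : E n →L[ℝ] E n} (hK : K.det ≠ 0) : IsUnit K :=
  ⟨(K.toContinuousLinearEquivOfDetNeZero hK).toUnit, by ext1 x; rfl⟩

lemma det_tproj_add_smul_rankOneSelf {n : ℕ} {u : E n} (hu : ‖u‖ = 1) (s : ℝ) :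
    (tproj u + s • rankOneSelf u).det = s := by
  have h : ((tproj u + s • rankOneSelf u : E n →L[ℝ] E n) : E n →ₗ[ℝ] E n)
      = LinearMap.transvection ((s - 1) • (innerSL ℝ u : E n →ₗ[ℝ] ℝ)) u := by
    ext1 x
    simp [LinearMap.transvection.apply, tproj_apply, rankOneSelf_apply]
    module
  rw [ContinuousLinearMap.det, h, LinearMap.transvection.det]
  simp [hu]

lemma trace_add_clm {n : ℕ} (M N : E n →L[ℝ] E n) :
    LinearMap.trace ℝ (E n) ((M + N : E n →L[ℝ] E n) : E n →ₗ[ℝ] E n)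
      = LinearMap.trace ℝ (E n) (M : E n →ₗ[ℝ] E n)
        + LinearMap.trace ℝ (E n) (N : E n →ₗ[ℝ] E n) :=
  map_add (LinearMap.trace ℝ (E n)) (M : E n →ₗ[ℝ] E n) (N : E n →ₗ[ℝ] E n)

lemma trace_smul_clm {n : ℕ} (c : ℝ) (M : E n →L[ℝ] E n) :
    LinearMap.trace ℝ (E n) ((c • M : E n →L[ℝ] E n) : E n →ₗ[ℝ] E n)
      = c * LinearMap.trace ℝ (E n) (M : E n →ₗ[ℝ] E n) :=
  map_smul (LinearMap.trace ℝ (E n)) c (M : E n →ₗ[ℝ] E n)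

lemma continuous_trace_clm {n : ℕ} :
    Continuous fun M : E n →L[ℝ] E n => LinearMap.trace ℝ (E n) (M : E n →ₗ[ℝ] E n) :=
  ((LinearMap.trace ℝ (E n)) ∘ₗ ContinuousLinearMap.coeLM ℝ).continuous_of_finiteDimensional

lemma rankOneSelf_mul_eq_zero {n : ℕ} {u : E n} {A : E n →L[ℝ] E n} (h : ∀ x, ⟪u, A x⟫ = 0) :
    rankOneSelf u * A = 0 := by
  ext1 x
  simp [rankOneSelf_apply, h]

lemma mul_rankOneSelf {n : ℕ} (u : E n) (A : E n →L[ℝ] E n) :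
    A * rankOneSelf u = (innerSL ℝ u).smulRight (A u) := by
  ext1 x
  simp [rankOneSelf_apply]

lemma rankOneSelf_mul_self {n : ℕ} {u : E n} (hu : ‖u‖ = 1) :
    rankOneSelf u * rankOneSelf u = rankOneSelf u := by
  ext1 x
  simp [rankOneSelf_apply, hu]

lemma eq_det_smul_inverse_mul_tproj {n : ℕ} {u : E n} {A C : E n →L[ℝ] E n}
    (hC : ∀ x, ⟪u, C x⟫ = 0) (hAC : A * C = (A + rankOneSelf u).det • tproj u)
    (hdet : (A + rankOneSelf u).det ≠ 0) :
    C = (A + rankOneSelf u).det • (Ring.inverse (A + rankOneSelf u) * tproj u) := by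
  have h1 : (A + rankOneSelf u) * C = (A + rankOneSelf u).det • tproj u := by
    rw [add_mul, rankOneSelf_mul_eq_zero hC, add_zero, hAC]
  have h2 : Ring.inverse (A + rankOneSelf u) * ((A + rankOneSelf u) * C) = C := by
    rw [← mul_assoc, Ring.inverse_mul_cancel _ (isUnit_of_det_ne_zero hdet), one_mul]
  conv_lhs => rw [← h2, h1]
  ext1 x; simp

open Polynomial Topology in
/-- The mixed coefficient of `s t` in `det (A + s + t B)`, where `A` is degenerate exactly in the
direction of the unit vector `u`, is the trace of `B` against the tangential cofactor of `A`. -/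
lemma mixed_coeff_det {n : ℕ} {v w : Fin (n + 1) → ℝ}
    (hw : ∀ p : ℝ[X], p.natDegree ≤ n → p.coeff 1 = ∑ i, w i * p.eval (v i))
    {u : E n} (hu : ‖u‖ = 1) {A B C : E n →L[ℝ] E n} (hAu : A u = 0) (hAT : ∀ x, ⟪u, A x⟫ = 0)
    (hB : ⟪u, B u⟫ = 0) (hC : ∀ x, ⟪u, C x⟫ = 0)
    (hAC : A * C = (A + rankOneSelf u).det • tproj u) (hdet : (A + rankOneSelf u).det ≠ 0) :
    ∑ i, w i * ∑ j, w j * (A + v i • (1 : E n →L[ℝ] E n) + v j • B).det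
      = LinearMap.trace ℝ (E n) ((C * B : E n →L[ℝ] E n) : E n →ₗ[ℝ] E n) := by
  set R := rankOneSelf u with hR
  set P := tproj u with hP
  have hPR : P = 1 - R := rfl
  have hRA : R * A = 0 := rankOneSelf_mul_eq_zero hAT
  have hAR : A * R = 0 := by rw [hR, mul_rankOneSelf, hAu]; ext1 x; simp
  have hRR : R * R = R := rankOneSelf_mul_self hu
  have hRP : R * P = 0 := by rw [hPR, mul_sub, mul_one, hRR, sub_self]
  have hPRz : P * R = 0 := by rw [hPR, sub_mul, one_mul, hRR, sub_self]
  let K : ℝ → (E n →L[ℝ] E n) := fun s => A + R + s • P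
  let ψ : ℝ → ℝ := fun s => (K s).det *
    LinearMap.trace ℝ (E n) ((Ring.inverse (K s) * (P * B) : E n →L[ℝ] E n) : E n →ₗ[ℝ] E n)
  have hK0 : K 0 = A + R := by ext1 x; simp [K]
  have hKc : Continuous K := by fun_prop
  have hKdet : ContinuousAt (fun s => (K s).det) 0 :=
    (ContinuousLinearMap.continuous_det.comp hKc).continuousAt
  have hψ : ContinuousAt ψ 0 := by
    refine hKdet.mul (continuous_trace_clm.continuousAt.comp ?_)
    refine ContinuousAt.mul ?_ continuousAt_const
    obtain ⟨U, hU⟩ := isUnit_of_det_ne_zero hdet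
    have h1 : ContinuousAt Ring.inverse (K 0) := by
      rw [hK0, ← hU]; exact NormedRing.inverse_continuousAt U
    exact ContinuousAt.comp h1 hKc.continuousAt
  have hψ0 : ψ 0 = LinearMap.trace ℝ (E n) ((C * B : E n →L[ℝ] E n) : E n →ₗ[ℝ] E n) := by
    have h2 : C = (A + R).det • (Ring.inverse (A + R) * P) :=
      eq_det_smul_inverse_mul_tproj hC hAC hdet
    simp only [ψ]
    rw [hK0, ← trace_smul_clm]
    conv_rhs => rw [h2]
    congr 2
  have key : ∀ᶠ s in 𝓝 (0 : ℝ), s ≠ 0 → ∀ p : ℝ[X],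
      (∀ t : ℝ, p.eval t = (A + s • (1 : E n →L[ℝ] E n) + t • B).det) → p.coeff 1 = s * ψ s := by
    have h1 : ∀ᶠ s in 𝓝 (0 : ℝ), (K s).det ≠ 0 := by
      refine hKdet.eventually_ne ?_
      rw [hK0]; exact hdet
    filter_upwards [h1] with s hs hs0 p hp
    have hunit := isUnit_of_det_ne_zero hs
    have hKR : K s * R = R := by
      simp only [K]
      rw [add_mul, add_mul, hAR, hRR, zero_add]
      have : (s • P) * R = 0 := by
        ext1 x
        have := congr($hPRz x)
        simp only [mul_apply_eq_comp] at this
        simp [this]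
      rw [this, add_zero]
    have hKinvR : Ring.inverse (K s) * R = R := by
      conv_lhs => rw [← hKR]
      rw [← mul_assoc, Ring.inverse_mul_cancel _ hunit, one_mul]
    have hRx : ∀ x, R (A x) = 0 := fun x => congr($hRA x)
    have hRRx : ∀ x, R (R x) = R x := fun x => congr($hRR x)
    have hPx : ∀ x, P x = x - R x := fun x => rfl
    have hM : A + s • (1 : E n →L[ℝ] E n) = (P + s • R) * K s := by
      ext1 x
      simp [K, hPx, hRx, hRRx]
      module
    have hMN : (A + s • (1 : E n →L[ℝ] E n)) * (Ring.inverse (K s) * (P + s⁻¹ • R)) = 1 := by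
      rw [hM, mul_assoc, ← mul_assoc (K s), Ring.mul_inverse_cancel _ hunit, one_mul]
      ext1 x
      simp [hPx, hRRx, hs0]
    rw [coeff_one_of_eval_eq_det hMN hp, hM, det_mul_clm, det_tproj_add_smul_rankOneSelf hu]
    have h4 : Ring.inverse (K s) * (P + s⁻¹ • R) * B
        = Ring.inverse (K s) * (P * B) + s⁻¹ • (R * B) := by
      conv_rhs => rw [← hKinvR]
      ext1 x
      simp
    have h5 : LinearMap.trace ℝ (E n) ((R * B : E n →L[ℝ] E n) : E n →ₗ[ℝ] E n) = 0 := by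
      have : LinearMap.trace ℝ (E n) ((R * B : E n →L[ℝ] E n) : E n →ₗ[ℝ] E n)
          = LinearMap.trace ℝ (E n) ((B * R : E n →L[ℝ] E n) : E n →ₗ[ℝ] E n) :=
        LinearMap.trace_mul_comm ℝ (R : E n →ₗ[ℝ] E n) (B : E n →ₗ[ℝ] E n)
      rw [this, hR, mul_rankOneSelf, trace_smulRight_clm]
      exact hB
    rw [h4, trace_add_clm, trace_smul_clm, h5]
    simp only [ψ]
    ring
  choose p hpdeg hpeval _ using fun j => exists_polynomial_det (A + v j • B) (1 : E n →L[ℝ] E n)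
  let q : ℝ[X] := ∑ j, Polynomial.C (w j) * p j
  have hqdeg : q.natDegree ≤ n :=
    natDegree_sum_le_of_forall_le _ _ fun j _ => (natDegree_C_mul_le _ _).trans (hpdeg j)
  have hqeval : ∀ s : ℝ, q.eval s
      = ∑ j, w j * (A + s • (1 : E n →L[ℝ] E n) + v j • B).det := by
    intro s
    simp only [q, eval_finsetSum, eval_mul, eval_C, hpeval]
    exact Finset.sum_congr rfl fun j _ => by rw [add_right_comm]
  have hqψ : ∀ᶠ s in 𝓝[≠] (0 : ℝ), q.eval s = s * ψ s := by
    filter_upwards [nhdsWithin_le_nhds key, self_mem_nhdsWithin] with s hs hs0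
    obtain ⟨r, hr, hre, _⟩ := exists_polynomial_det (A + s • (1 : E n →L[ℝ] E n)) B
    rw [← hs hs0 r hre, hw r hr, hqeval]
    simp only [hre]
  have hq0 : q.coeff 0 = 0 := by
    have h1 : Filter.Tendsto (fun s => q.eval s) (𝓝[≠] 0) (𝓝 (q.eval 0)) :=
      q.continuous.continuousAt.tendsto.mono_left nhdsWithin_le_nhds
    have h2 : Filter.Tendsto (fun s => s * ψ s) (𝓝[≠] 0) (𝓝 (0 * ψ 0)) :=
      (continuousAt_id.mul hψ).tendsto.mono_left nhdsWithin_le_nhds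
    have := tendsto_nhds_unique (h1.congr' hqψ) h2
    rw [coeff_zero_eq_eval_zero, this, zero_mul]
  have hdiv : q = q.divX * X := by
    conv_lhs => rw [← divX_mul_X_add q, hq0, C_0, add_zero]
  have hlim : q.coeff 1 = ψ 0 := by
    have h1 : Filter.Tendsto (fun s => q.divX.eval s) (𝓝[≠] 0) (𝓝 (q.divX.eval 0)) :=
      q.divX.continuous.continuousAt.tendsto.mono_left nhdsWithin_le_nhds
    have h2 : ∀ᶠ s in 𝓝[≠] (0 : ℝ), q.divX.eval s = ψ s := by
      filter_upwards [hqψ, self_mem_nhdsWithin] with s hs hs0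
      rw [hdiv, eval_mul, eval_X, mul_comm] at hs
      exact mul_left_cancel₀ hs0 hs
    have := tendsto_nhds_unique (h1.congr' h2) (hψ.tendsto.mono_left nhdsWithin_le_nhds)
    rw [← this, ← coeff_zero_eq_eval_zero, coeff_divX]
  rw [← hψ0, ← hlim, hw q hqdeg]
  simp only [hqeval]

open Set in
lemma bijective_add_smul {n : ℕ} {X : E n → E n} {L : NNReal} (hL : LipschitzWith L X) {t : ℝ}
    (ht : 0 ≤ t) (htL : t * L < 1) : Function.Bijective fun x => x + t • X x := by
  have happ : ApproximatesLinearOn (fun x => x + t • X x)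
      ((ContinuousLinearEquiv.refl ℝ (E n) : E n ≃L[ℝ] E n) : E n →L[ℝ] E n) univ
      (⟨t, ht⟩ * L) := by
    intro x _ y _
    have h1 : (x + t • X x) - (y + t • X y) - (x - y) = t • (X x - X y) := by module
    have h2 := hL.dist_le_mul x y
    rw [dist_eq_norm, dist_eq_norm] at h2
    have h3 : ‖t • (X x - X y)‖ ≤ t * L * ‖x - y‖ := by
      rw [norm_smul, Real.norm_of_nonneg ht, mul_assoc]
      exact mul_le_mul_of_nonneg_left h2 ht
    change ‖(x + t • X x) - (y + t • X y) - (x - y)‖ ≤ t * L * ‖x - y‖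
    rw [h1]
    exact h3
  rcases subsingleton_or_nontrivial (E n) with hs | hs
  · exact ⟨Function.injective_of_subsingleton _, fun y => ⟨y, Subsingleton.elim _ _⟩⟩
  have hc : Subsingleton (E n) ∨ (⟨t, ht⟩ * L : NNReal) <
      ‖((ContinuousLinearEquiv.refl ℝ (E n)).symm : E n →L[ℝ] E n)‖₊⁻¹ := by
    right
    have : ‖((ContinuousLinearEquiv.refl ℝ (E n)).symm : E n →L[ℝ] E n)‖₊ = 1 := by
      ext; exact ContinuousLinearMap.norm_id
    rw [this, inv_one, ← NNReal.coe_lt_coe]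
    exact htL
  exact ⟨injOn_univ.1 (happ.injOn hc), happ.surjective hc⟩

open Set Topology in
/-- Small perturbations of the identity supported in a ball preserve its volume. -/
lemma exists_integral_det_one_add_smul {n : ℕ} {X : E n → E n} (hX : ContDiff ℝ 1 X)
    (hc : HasCompactSupport X) {Ω : Set (E n)} (hΩm : MeasurableSet Ω) (hΩ : tsupport X ⊆ Ω) :
    ∃ t₀ > 0, ∀ t ∈ Ioc (0 : ℝ) t₀,
      ∫ x in Ω, (1 + t • fderiv ℝ X x).det = (volume : Measure (E n)).real Ω := by
  obtain ⟨L, hL⟩ := hX.lipschitzWith_of_hasCompactSupport hc one_ne_zero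
  have hpos : ∀ᶠ N in 𝓝 (1 : E n →L[ℝ] E n), 0 < N.det := by
    refine ContinuousLinearMap.continuous_det.continuousAt.eventually_const_lt ?_
    simp [ContinuousLinearMap.det]
  obtain ⟨δ, hδ, hball⟩ := Metric.eventually_nhds_iff.1 hpos
  have hLpos : 0 < (L : ℝ) + 1 := by positivity
  refine ⟨min (δ / 2) (1 / 2) / (L + 1), by positivity, fun t ht => ?_⟩
  have h1 : t * (L + 1) ≤ min (δ / 2) (1 / 2) := (le_div_iff₀ hLpos).1 ht.2
  have ht0 : 0 ≤ t := ht.1.le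
  have htL : t * L < 1 := by
    have := h1.trans (min_le_right _ _)
    nlinarith [ht.1]
  have htδ : t * L < δ := by
    have := h1.trans (min_le_left _ _)
    nlinarith [ht.1]
  obtain ⟨hinj, hsurj⟩ := bijective_add_smul hL ht0 htL
  set f : E n → E n := fun x => x + t • X x with hf
  have hout : ∀ x, x ∉ Ω → f x = x := fun x hx => by
    have : X x = 0 := image_eq_zero_of_notMem_tsupport fun h => hx (hΩ h)
    simp [hf, this]
  have himage : f '' Ω = Ω := by
    ext y
    constructor
    · rintro ⟨x, hx, rfl⟩
      by_contra hy
      exact hy (by rw [hinj (hout _ hy)]; exact hx)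
    · intro hy
      obtain ⟨x, rfl⟩ := hsurj y
      refine ⟨x, ?_, rfl⟩
      by_contra hx
      exact hx (by rwa [hout x hx] at hy)
  have hderiv : ∀ x ∈ Ω, HasFDerivWithinAt f (1 + t • fderiv ℝ X x) Ω x := fun x _ =>
    ((hasFDerivAt_id x).add
      (((hX.differentiable one_ne_zero) x).hasFDerivAt.const_smul t)).hasFDerivWithinAt
  have hcv := integral_image_eq_integral_abs_det_fderiv_smul volume hΩm hderiv hinj.injOn
    (fun _ => (1 : ℝ))
  rw [himage] at hcv
  have habs : ∀ x, |(1 + t • fderiv ℝ X x).det| = (1 + t • fderiv ℝ X x).det := fun x => by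
    refine abs_of_pos (hball ?_)
    rw [dist_eq_norm, add_sub_cancel_left, norm_smul, Real.norm_of_nonneg ht0]
    refine lt_of_le_of_lt ?_ htδ
    exact mul_le_mul_of_nonneg_left (norm_fderiv_le_of_lipschitz ℝ hL) ht0
  simp only [habs, smul_eq_mul, mul_one] at hcv
  rw [← hcv]
  simp

open Set in
/-- The Jacobian determinant of a compactly supported `C¹` vector field has zero integral. -/
theorem integral_det_fderiv_eq_zero {n : ℕ} (hn : n ≠ 0) {X : E n → E n} (hX : ContDiff ℝ 1 X)
    (hc : HasCompactSupport X) : ∫ x, (fderiv ℝ X x).det = 0 := by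
  obtain ⟨R, hR⟩ := hc.isBounded.subset_ball 0
  set Ω := ball (0 : E n) R with hΩ
  obtain ⟨t₀, ht₀, ht⟩ := exists_integral_det_one_add_smul hX hc measurableSet_ball hR
  let v : Fin (n + 1) → ℝ := fun i => t₀ / (i + 1)
  have hv : Function.Injective v := fun i j hij => by
    have h1 : ((i : ℕ) + 1 : ℝ) ≠ 0 := by positivity
    have h2 : ((j : ℕ) + 1 : ℝ) ≠ 0 := by positivity
    have h3 : t₀ / ((i : ℕ) + 1 : ℝ) = t₀ / ((j : ℕ) + 1 : ℝ) := hij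
    rw [div_eq_div_iff h1 h2] at h3
    have h4 := mul_left_cancel₀ ht₀.ne' h3
    ext
    have : (j : ℝ) = i := by linarith
    exact_mod_cast this.symm
  have hvt : ∀ i, v i ∈ Ioc 0 t₀ := fun i =>
    ⟨by positivity, div_le_self ht₀.le (by linarith [(i : ℕ).cast_nonneg (α := ℝ)])⟩
  obtain ⟨w, hw⟩ := exists_coeff_weights v hv n
  have hsum : ∑ i, w i = 0 := by
    have := hw 1 (by simp)
    simpa [Polynomial.coeff_one, hn] using this.symm
  have hpt : ∀ x, (fderiv ℝ X x).det = ∑ i, w i * (1 + v i • fderiv ℝ X x).det := fun x => by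
    obtain ⟨p, hp, hpe, hpn⟩ := exists_polynomial_det 1 (fderiv ℝ X x)
    rw [← hpn, hw p hp]
    simp only [hpe]
  have hsupp : Function.support (fun x => (fderiv ℝ X x).det) ⊆ Ω := by
    intro x hx
    by_contra hxΩ
    have h1 : fderiv ℝ X x = 0 := by
      by_contra h2
      exact hxΩ (hR (support_fderiv_subset ℝ h2))
    refine hx ?_
    have : Nonempty (Fin n) := ⟨⟨0, Nat.pos_of_ne_zero hn⟩⟩
    simp [h1, ContinuousLinearMap.det]
  rw [← setIntegral_eq_integral_of_forall_compl_eq_zero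
    (fun x hx => Function.notMem_support.1 fun h => hx (hsupp h))]
  simp only [hpt]
  rw [integral_finsetSum]
  · simp only [integral_const_mul]
    rw [Finset.sum_congr rfl fun i _ => by rw [ht (v i) (hvt i)], ← Finset.sum_mul, hsum,
      zero_mul]
  · intro i _
    have hD : Continuous (fderiv ℝ X) := hX.continuous_fderiv one_ne_zero
    have hcont : Continuous fun x => w i * (1 + v i • fderiv ℝ X x).det :=
      continuous_const.mul (ContinuousLinearMap.continuous_det.comp (by fun_prop))
    exact (hcont.continuousOn.integrableOn_compact (isCompact_closedBall 0 R)).mono_set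
      ball_subset_closedBall

/-- The isometry of the unit sphere induced by a linear isometry. -/
def sphereIsometry {n : ℕ} (G : E n ≃ₗᵢ[ℝ] E n) :
    sphere (0 : E n) 1 ≃ᵢ sphere (0 : E n) 1 where
  toFun x := ⟨G x, by simp⟩
  invFun x := ⟨G.symm x, by simp⟩
  left_inv x := by simp
  right_inv x := by simp
  isometry_toFun := Isometry.of_dist_eq fun x y => by simp [Subtype.dist_eq]

lemma exists_sphereIsometry_apply_eq {n : ℕ} (x y : sphere (0 : E n) 1) :
    ∃ G : E n ≃ₗᵢ[ℝ] E n, sphereIsometry G x = y := by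
  refine ⟨(ℝ ∙ ((x : E n) - y))ᗮ.reflection, Subtype.ext ?_⟩
  exact Submodule.reflection_sub (by simp)

open Set Pointwise in
lemma measurePreserving_sphereIsometry_toSphere {n : ℕ} (G : E n ≃ₗᵢ[ℝ] E n) :
    MeasurePreserving (sphereIsometry G) (volume : Measure (E n)).toSphere
      (volume : Measure (E n)).toSphere := by
  have hmeas : Measurable (sphereIsometry G) := (sphereIsometry G).continuous.measurable
  refine ⟨hmeas, Measure.ext fun s hs => ?_⟩
  rw [Measure.map_apply hmeas hs, Measure.toSphere_apply' _ hs,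
    Measure.toSphere_apply' _ (hmeas hs)]
  congr 1
  have h : (Ioo (0 : ℝ) 1 • ((↑) '' (sphereIsometry G ⁻¹' s)) : Set (E n))
      = G ⁻¹' (Ioo (0 : ℝ) 1 • ((↑) '' s)) := by
    ext z
    simp only [Set.mem_smul, mem_image, mem_preimage]
    constructor
    · rintro ⟨r, hr, _, ⟨x, hx, rfl⟩, rfl⟩
      exact ⟨r, hr, _, ⟨_, hx, rfl⟩, by simp [sphereIsometry]⟩
    · rintro ⟨r, hr, _, ⟨x, hx, rfl⟩, hz⟩
      refine ⟨r, hr, _, ⟨(sphereIsometry G).symm x, by simpa using hx, rfl⟩, ?_⟩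
      apply G.injective
      rw [← hz, map_smul]
      congr 1
      exact congr(($((sphereIsometry G).apply_symm_apply x) : E n))
  rw [h]
  exact G.measurePreserving.measure_preimage_emb G.toHomeomorph.measurableEmbedding _

section
variable {n : ℕ} {μ σ : Measure (sphere (0 : E n) 1)}

lemma integrable_of_continuous_sphere [IsFiniteMeasure μ] {f : sphere (0 : E n) 1 → ℝ}
    (hf : Continuous f) : Integrable f μ :=
  hf.integrable_of_hasCompactSupport (HasCompactSupport.of_compactSpace f)

lemma integral_max_sub_dist_eq (hμ : ∀ G, MeasurePreserving (sphereIsometry (n := n) G) μ μ)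
    (δ : ℝ) (x y : sphere (0 : E n) 1) :
    ∫ z, max 0 (δ - dist x z) ∂μ = ∫ z, max 0 (δ - dist y z) ∂μ := by
  obtain ⟨G, hG⟩ := exists_sphereIsometry_apply_eq x y
  rw [← (hμ G).integral_comp (sphereIsometry G).toHomeomorph.measurableEmbedding
    (fun z => max 0 (δ - dist y z)), ← hG]
  simp [(sphereIsometry G).dist_eq]

/-- Two finite measures on a compact metric space for which all balls of equal radius look alike
annihilate the same continuous functions. -/
lemma integral_eq_zero_of_integral_max_sub_dist {X : Type*} [MetricSpace X] [CompactSpace X]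
    [MeasurableSpace X] [BorelSpace X] {μ σ : Measure X} [IsFiniteMeasure μ] [IsFiniteMeasure σ]
    [σ.IsOpenPosMeasure]
    (hμ : ∀ δ x y, ∫ z, max 0 (δ - dist x z) ∂μ = ∫ z, max 0 (δ - dist y z) ∂μ)
    (hσ : ∀ δ x y, ∫ z, max 0 (δ - dist x z) ∂σ = ∫ z, max 0 (δ - dist y z) ∂σ)
    {f : X → ℝ} (hf : Continuous f) (h0 : ∫ x, f x ∂σ = 0) : ∫ x, f x ∂μ = 0 := by
  rcases isEmpty_or_nonempty X with he | ⟨⟨x₀⟩⟩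
  · simp [Measure.eq_zero_of_isEmpty μ]
  have hic : ∀ {m : Measure X} [IsFiniteMeasure m] {g : X → ℝ}, Continuous g → Integrable g m :=
    fun hg => hg.integrable_of_hasCompactSupport (HasCompactSupport.of_compactSpace _)
  have huc := CompactSpace.uniformContinuous_of_continuous hf
  suffices h : ∀ ε > 0, |∫ x, f x ∂μ| ≤ ε * μ.real Set.univ by
    by_contra hne
    have hpos : 0 < |∫ x, f x ∂μ| := abs_pos.2 hne
    have hm : 0 < μ.real Set.univ + 1 := by positivity
    have := h (|∫ x, f x ∂μ| / (2 * (μ.real Set.univ + 1))) (by positivity)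
    rw [div_mul_eq_mul_div, le_div_iff₀ (by positivity)] at this
    nlinarith [measureReal_nonneg (μ := μ) (s := Set.univ)]
  intro ε hε
  obtain ⟨δ, hδ, hfδ⟩ := Metric.uniformContinuous_iff.1 huc ε hε
  set k : X → X → ℝ := fun x y => max 0 (δ - dist x y) with hk
  have hkc : Continuous fun p : X × X => k p.1 p.2 := by
    fun_prop
  have hknn : ∀ x y, 0 ≤ k x y := fun x y => le_max_left _ _
  have hksymm : ∀ x y, k x y = k y x := fun x y => by simp only [hk, dist_comm]
  have hkx : ∀ x, Continuous (k x) := fun x => hkc.comp (by fun_prop : Continuous fun y => (x, y))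
  set κ := ∫ y, k x₀ y ∂σ with hκ
  have hκx : ∀ x, ∫ y, k x y ∂σ = κ := fun x => hσ δ x x₀
  have hκpos : 0 < κ := by
    refine (hkx x₀).integral_pos_of_hasCompactSupport_nonneg_nonzero
      (HasCompactSupport.of_compactSpace _) (hknn x₀) (x := x₀) ?_
    simp [hk, hδ.le, hδ.ne']
  have hprod : Continuous fun p : X × X =>
      f p.2 * k p.1 p.2 := (hf.comp continuous_snd).mul hkc
  have hYint : Integrable (fun p : X × X =>
      f p.2 * k p.1 p.2) (μ.prod σ) :=
    hprod.integrable_of_hasCompactSupport (HasCompactSupport.of_compactSpace _)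
  have hzero : ∫ y, ∫ x, f x * k y x ∂σ ∂μ = 0 := by
    rw [integral_integral_swap hYint]
    simp only [integral_const_mul]
    have h1 : ∀ x, ∫ y, k y x ∂μ = ∫ y, k x₀ y ∂μ := fun x => by
      simp only [fun y => hksymm y x]
      exact hμ δ x x₀
    simp only [h1, integral_mul_const, h0, zero_mul]
  have hmain : κ * ∫ y, f y ∂μ = ∫ y, ∫ x, (f y - f x) * k y x ∂σ ∂μ := by
    have h1 : ∀ y, ∫ x, (f y - f x) * k y x ∂σ = f y * κ - ∫ x, f x * k y x ∂σ := fun y => by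
      simp only [sub_mul]
      rw [integral_sub, integral_const_mul, hκx]
      · exact hic ((hkx y).const_mul _)
      · exact hic (hf.mul (hkx y))
    simp only [h1]
    rw [integral_sub, hzero, integral_mul_const, sub_zero, mul_comm]
    · exact (hic hf).mul_const _
    · exact hYint.integral_prod_left
  have hbound : ∀ y, ‖∫ x, (f y - f x) * k y x ∂σ‖ ≤ ε * κ := fun y => by
    rw [← hκx y, ← integral_const_mul]
    refine norm_integral_le_of_norm_le
      (hic ((hkx y).const_mul _)) (Filter.Eventually.of_forall ?_)
    intro x
    rw [norm_mul, Real.norm_of_nonneg (hknn y x)]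
    rcases lt_or_ge (dist y x) δ with hd | hd
    · refine mul_le_mul_of_nonneg_right ?_ (hknn y x)
      have := hfδ hd
      rw [Real.dist_eq] at this
      exact this.le
    · have : k y x = 0 := max_eq_left (by linarith)
      simp [this]
  have hfinal := norm_integral_le_of_norm_le_const (μ := μ) (Filter.Eventually.of_forall hbound)
  rw [← hmain, norm_mul, Real.norm_of_nonneg hκpos.le, Real.norm_eq_abs] at hfinal
  have : κ * |∫ y, f y ∂μ| ≤ κ * (ε * μ.real Set.univ) := by linarith
  exact le_of_mul_le_mul_left this hκpos

/-- Two finite rotation-invariant measures on the sphere annihilate the same continuous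
functions. -/
lemma integral_eq_zero_of_invariant {n : ℕ} {μ σ : Measure (sphere (0 : E n) 1)}
    [IsFiniteMeasure μ] [IsFiniteMeasure σ]
    [σ.IsOpenPosMeasure] (hμ : ∀ G, MeasurePreserving (sphereIsometry (n := n) G) μ μ)
    (hσ : ∀ G, MeasurePreserving (sphereIsometry (n := n) G) σ σ)
    {f : sphere (0 : E n) 1 → ℝ} (hf : Continuous f) (h0 : ∫ x, f x ∂σ = 0) :
    ∫ x, f x ∂μ = 0 :=
  integral_eq_zero_of_integral_max_sub_dist (integral_max_sub_dist_eq hμ)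
    (integral_max_sub_dist_eq hσ) hf h0

open Topology in
/-- A continuous function integrable against an infinite rotation-invariant measure on the
sphere vanishes. -/
lemma eq_zero_of_integrable_of_invariant
    (hμ : ∀ G, MeasurePreserving (sphereIsometry (n := n) G) μ μ) (hinf : μ Set.univ = ∞)
    {f : sphere (0 : E n) 1 → ℝ} (hf : Continuous f) (hfi : Integrable f μ) : f = 0 := by
  by_contra hne
  obtain ⟨x₀, hx₀⟩ := Function.ne_iff.1 hne
  have hx₀' : 0 < ‖f x₀‖ := norm_pos_iff.2 hx₀
  set U := {x | ‖f x₀‖ / 2 < ‖f x‖} with hU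
  have hUo : IsOpen U := isOpen_lt continuous_const hf.norm
  have hUfin : μ U < ∞ := hfi.measure_norm_gt_lt_top (half_pos hx₀')
  have hloc : ∀ x ∈ (Set.univ : Set (sphere (0 : E n) 1)), μ.FiniteAtFilter (𝓝[Set.univ] x) := by
    intro x _
    obtain ⟨G, hG⟩ := exists_sphereIsometry_apply_eq x x₀
    refine ⟨sphereIsometry G ⁻¹' U, ?_, ?_⟩
    · rw [nhdsWithin_univ]
      refine (hUo.preimage (sphereIsometry G).continuous).mem_nhds ?_
      simpa [hU, hG] using hx₀
    · rwa [(hμ G).measure_preimage hUo.measurableSet.nullMeasurableSet]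
  exact (isCompact_univ.measure_lt_top_of_nhdsWithin hloc).ne hinf

/-- A continuous function whose integral over the sphere vanishes for the surface measure induced
by Lebesgue measure has vanishing integral for every rotation-invariant measure. -/
lemma integral_eq_zero_of_toSphere (hμ : ∀ G, MeasurePreserving (sphereIsometry (n := n) G) μ μ)
    {f : sphere (0 : E n) 1 → ℝ} (hf : Continuous f)
    (h0 : ∫ x, f x ∂(volume : Measure (E n)).toSphere = 0) : ∫ x, f x ∂μ = 0 := by
  by_cases hfin : μ Set.univ = ∞
  · by_cases hfi : Integrable f μ
    · simp [eq_zero_of_integrable_of_invariant hμ hfin hf hfi]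
    · exact integral_undef hfi
  · have : IsFiniteMeasure μ := ⟨lt_top_iff_ne_top.2 hfin⟩
    exact integral_eq_zero_of_invariant hμ measurePreserving_sphereIsometry_toSphere hf h0

lemma integral_eq_of_toSphere (hμ : ∀ G, MeasurePreserving (sphereIsometry (n := n) G) μ μ)
    {f g : sphere (0 : E n) 1 → ℝ} (hf : Continuous f) (hg : Continuous g)
    (h0 : ∫ x, (f x - g x) ∂(volume : Measure (E n)).toSphere = 0) :
    ∫ x, f x ∂μ = ∫ x, g x ∂μ := by
  by_cases hfin : μ Set.univ = ∞
  · have h : ∀ {f : sphere (0 : E n) 1 → ℝ}, Continuous f → ∫ x, f x ∂μ = 0 := fun {f} hf => by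
      by_cases hfi : Integrable f μ
      · simp [eq_zero_of_integrable_of_invariant hμ hfin hf hfi]
      · exact integral_undef hfi
    rw [h hf, h hg]
  · have : IsFiniteMeasure μ := ⟨lt_top_iff_ne_top.2 hfin⟩
    have := integral_eq_zero_of_toSphere hμ (hf.sub hg) h0
    simp only [Pi.sub_apply] at this
    rwa [integral_sub (integrable_of_continuous_sphere hf) (integrable_of_continuous_sphere hg),
      sub_eq_zero] at this
end

lemma setIntegral_sphere_hausdorffMeasure {n : ℕ} {d : ℝ} (hd : 0 ≤ d) (f : E n → ℝ) :
    ∫ u in sphere (0 : E n) 1, f u ∂μH[d] = ∫ u : sphere (0 : E n) 1, f u ∂μH[d] := by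
  have hs : MeasurableSet (sphere (0 : E n) 1) := isClosed_sphere.measurableSet
  rw [← integral_subtype_comap hs]
  congr 1
  refine Measure.ext fun s _ => ?_
  rw [comap_subtype_coe_apply hs]
  exact isometry_subtype_coe.hausdorffMeasure_image (Or.inl hd) s

open Set in
/-- Integration in polar coordinates of a product of a radial and an angular factor. -/
lemma integral_eq_toSphere_mul {n : ℕ} (hn : n ≠ 0) {F : E n → ℝ} {g : ℝ → ℝ}
    {f : sphere (0 : E n) 1 → ℝ}
    (hF : ∀ (u : sphere (0 : E n) 1) (r : ℝ), 0 < r → F (r • (u : E n)) = f u * g r) :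
    ∫ x, F x = (∫ u, f u ∂(volume : Measure (E n)).toSphere)
      * ∫ r in Ioi (0 : ℝ), r ^ (n - 1) * g r := by
  have : Nontrivial (E n) := by
    have : Nonempty (Fin n) := ⟨⟨0, Nat.pos_of_ne_zero hn⟩⟩
    infer_instance
  calc
    ∫ x, F x = ∫ x : ({0}ᶜ : Set (E n)), F x ∂((volume : Measure (E n)).comap (↑)) := by
      rw [integral_subtype_comap (measurableSet_singleton _).compl F, restrict_compl_singleton]
    _ = ∫ p, f p.1 * g p.2 ∂(volume : Measure (E n)).toSphere.prod
          (.volumeIoiPow (Module.finrank ℝ (E n) - 1)) := by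
      rw [← (volume : Measure (E n)).measurePreserving_homeomorphUnitSphereProd.integral_comp
        (Homeomorph.measurableEmbedding _)]
      refine integral_congr_ae (Filter.Eventually.of_forall fun x => ?_)
      have hx : 0 < ‖(x : E n)‖ := norm_pos_iff.2 x.2
      have := hF ((homeomorphUnitSphereProd (E n)) x).1 ‖(x : E n)‖ hx
      simp only [homeomorphUnitSphereProd_apply_fst_coe, smul_inv_smul₀ hx.ne'] at this
      simp [this]
    _ = _ := by
      rw [integral_prod_mul f (fun r : Ioi (0 : ℝ) => g r)]
      congr 1
      simp only [Measure.volumeIoiPow, ENNReal.ofReal]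
      rw [integral_withDensity_eq_integral_smul,
        integral_subtype_comap measurableSet_Ioi
          fun a ↦ Real.toNNReal (a ^ (Module.finrank ℝ (E n) - 1)) • g a,
        setIntegral_congr_fun measurableSet_Ioi fun x hx ↦ ?_]
      · simp [NNReal.smul_def, Real.coe_toNNReal _ (pow_nonneg (mem_Ioi.1 hx).le _)]
      · exact (measurable_subtype_coe.pow_const _).real_toNNReal

section Homogeneous
variable {n : ℕ} {F : Type*} [NormedAddCommGroup F] [NormedSpace ℝ F] {V : E n → F}

lemma smul_fderiv_smul_of_homogeneous (hV : ∀ t : ℝ, 0 < t → ∀ x, V (t • x) = V x) {t : ℝ}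
    (ht : 0 < t) (x : E n) : t • fderiv ℝ V (t • x) = fderiv ℝ V x := by
  rw [← fderiv_comp_smul]
  simp only [hV t ht]

lemma fderiv_apply_self_of_homogeneous (hV : ∀ t : ℝ, 0 < t → ∀ x, V (t • x) = V x) {x : E n}
    (hd : DifferentiableAt ℝ V x) : fderiv ℝ V x x = 0 := by
  have h1 : HasDerivAt (fun t : ℝ => t • x) x 1 := by
    simpa using (hasDerivAt_id (1 : ℝ)).smul_const x
  have h2 : HasDerivAt (fun t : ℝ => V (t • x)) (fderiv ℝ V x x) 1 := by
    refine HasFDerivAt.comp_hasDerivAt (1 : ℝ) (l := V) ?_ h1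
    rw [one_smul]
    exact hd.hasFDerivAt
  have h3 : HasDerivAt (fun t : ℝ => V (t • x)) 0 1 := by
    refine (hasDerivAt_const (1 : ℝ) (V x)).congr_of_eventuallyEq ?_
    filter_upwards [lt_mem_nhds one_pos] with t ht using hV t ht x
  exact h2.unique h3
end Homogeneous

section memC
variable {n : ℕ} {h : E n → ℝ}

lemma memC.contDiffAt (hh : memC n h) {x : E n} (hx : x ≠ 0) : ContDiffAt ℝ 2 h x :=
  hh.2.1.contDiffAt (isOpen_compl_singleton.mem_nhds hx)

lemma memC.differentiableAt (hh : memC n h) {x : E n} (hx : x ≠ 0) : DifferentiableAt ℝ h x :=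
  (hh.contDiffAt hx).differentiableAt (by norm_num)

lemma memC.contDiffOn_gradient (hh : memC n h) : ContDiffOn ℝ 1 (gradient h) {(0 : E n)}ᶜ :=
  (InnerProductSpace.toDual ℝ (E n)).symm.contDiff.comp_contDiffOn
    (hh.2.1.fderiv_of_isOpen isOpen_compl_singleton (by norm_num))

lemma memC.differentiableAt_gradient (hh : memC n h) {x : E n} (hx : x ≠ 0) :
    DifferentiableAt ℝ (gradient h) x :=
  (hh.contDiffOn_gradient.contDiffAt (isOpen_compl_singleton.mem_nhds hx)).differentiableAt
    one_ne_zero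

lemma memC.continuousOn_sHess (hh : memC n h) : ContinuousOn (sHess h) {(0 : E n)}ᶜ :=
  hh.contDiffOn_gradient.continuousOn_fderiv_of_isOpen isOpen_compl_singleton le_rfl

lemma memC.gradient_smul (hh : memC n h) (t : ℝ) (ht : 0 < t) (x : E n) :
    gradient h (t • x) = gradient h x := by
  rcases eq_or_ne x 0 with rfl | hx
  · simp
  have h1 : t • fderiv ℝ h (t • x) = t • fderiv ℝ h x := by
    rw [← fderiv_comp_smul, ← fderiv_const_smul (hh.differentiableAt hx)]
    congr 1
    ext y
    exact hh.1 t ht y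
  simp only [gradient, smul_right_injective _ ht.ne' h1]

lemma memC.sHess_smul (hh : memC n h) {t : ℝ} (ht : 0 < t) (x : E n) :
    sHess h (t • x) = t⁻¹ • sHess h x := by
  rw [sHess, sHess, ← smul_fderiv_smul_of_homogeneous hh.gradient_smul ht x,
    inv_smul_smul₀ ht.ne']

lemma memC.sHess_apply_self (hh : memC n h) {x : E n} (hx : x ≠ 0) : sHess h x x = 0 :=
  fderiv_apply_self_of_homogeneous hh.gradient_smul (hh.differentiableAt_gradient hx)

lemma memC.inner_gradient_self (hh : memC n h) {x : E n} (hx : x ≠ 0) :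
    ⟪gradient h x, x⟫ = h x := by
  rw [inner_gradient_left]
  have h1 : HasDerivAt (fun t : ℝ => t • x) x 1 := by
    simpa using (hasDerivAt_id (1 : ℝ)).smul_const x
  have h2 : HasDerivAt (fun t : ℝ => h (t • x)) (fderiv ℝ h x x) 1 := by
    refine HasFDerivAt.comp_hasDerivAt (1 : ℝ) (l := h) ?_ h1
    rw [one_smul]
    exact (hh.differentiableAt hx).hasFDerivAt
  have h3 : HasDerivAt (fun t : ℝ => h (t • x)) (h x) 1 := by
    have h4 : HasDerivAt (fun t : ℝ => t * h x) (h x) 1 := by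
      simpa using (hasDerivAt_id (1 : ℝ)).mul_const (h x)
    refine h4.congr_of_eventuallyEq ?_
    filter_upwards [lt_mem_nhds one_pos] with t ht using hh.1 t ht x
  exact h2.unique h3

lemma memC.inner_sHess_symm (hh : memC n h) {x : E n} (hx : x ≠ 0) (v w : E n) :
    ⟪sHess h x v, w⟫ = ⟪v, sHess h x w⟫ := by
  have hfd : DifferentiableAt ℝ (fderiv ℝ h) x :=
    ((hh.contDiffAt hx).fderiv_right (m := 1) (by norm_num)).differentiableAt one_ne_zero
  have key : ∀ v w, ⟪sHess h x v, w⟫ = fderiv ℝ (fderiv ℝ h) x v w := by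
    intro v w
    have h1 := (hh.differentiableAt_gradient hx).hasFDerivAt.inner ℝ (hasFDerivAt_const w x)
    have h2 := hfd.hasFDerivAt.clm_apply (hasFDerivAt_const w x)
    simp only [inner_gradient_left] at h1
    simpa [sHess] using congr($(h1.unique h2) v)
  have hs : IsSymmSndFDerivAt ℝ h x := (hh.contDiffAt hx).isSymmSndFDerivAt (by simp)
  rw [key, hs.eq, ← key, real_inner_comm]

end memC

lemma det_smul_clm {n : ℕ} (c : ℝ) (M : E n →L[ℝ] E n) : (c • M).det = c ^ n * M.det := by
  have h := LinearMap.det_smul c (M : E n →ₗ[ℝ] E n)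
  rw [finrank_euclideanSpace_fin] at h
  exact h

section Cofactor
variable {n : ℕ} {h : E n → ℝ} {u : E n}

lemma memC.inner_sHess_eq_zero (hh : memC n h) (hu : ‖u‖ = 1) (x : E n) :
    ⟪u, sHess h u x⟫ = 0 := by
  have hu0 : u ≠ 0 := norm_ne_zero_iff.1 (by simp [hu])
  rw [← hh.inner_sHess_symm hu0, hh.sHess_apply_self hu0, inner_zero_left]

lemma memC.sdet_eq (hh : memC n h) (hu : ‖u‖ = 1) :
    sdet h u = (sHess h u + rankOneSelf u).det := by
  have hu0 : u ≠ 0 := norm_ne_zero_iff.1 (by simp [hu])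
  rw [sdet, ContinuousLinearMap.det]
  congr 2
  ext1 x
  simp [tproj_apply, rankOneSelf_apply, hh.inner_sHess_eq_zero hu, hh.sHess_apply_self hu0]

lemma memC.det_ne_zero (hh : memC n h) (hu : ‖u‖ = 1) :
    (sHess h u + rankOneSelf u).det ≠ 0 := by
  intro h0
  obtain ⟨x, hx, hx0⟩ := (Submodule.ne_bot_iff _).1 (LinearMap.bot_lt_ker_of_det_eq_zero h0).ne'
  replace hx : sHess h u x + ⟪u, x⟫ • u = 0 := by
    simpa [rankOneSelf_apply] using hx
  have hux : ⟪u, x⟫ = 0 := by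
    have := congr(⟪u, $hx⟫)
    simpa [inner_add_right, inner_smul_right, hh.inner_sHess_eq_zero hu, hu] using this
  have hpos := hh.2.2 u (by simpa using hu) x
    (Submodule.mem_orthogonal_singleton_iff_inner_right.2 hux) hx0
  rw [hux, zero_smul, add_zero] at hx
  simp [hx] at hpos

variable {Cof : E n → E n →L[ℝ] E n}

lemma memC.sHess_mul_cof (hh : memC n h)
    (hCinv : ∀ u ∈ sphere (0 : E n) 1, (sHess h u).comp (Cof u) = sdet h u • tproj u)
    (hu : ‖u‖ = 1) :
    sHess h u * Cof u = (sHess h u + rankOneSelf u).det • tproj u := by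
  rw [← hh.sdet_eq hu]
  exact hCinv u (by simpa using hu)

lemma inner_cof_eq_zero (hCtan : ∀ u ∈ sphere (0 : E n) 1, ∀ v : E n, Cof u v ∈ (ℝ ∙ u)ᗮ)
    (hu : ‖u‖ = 1) (x : E n) : ⟪u, Cof u x⟫ = 0 :=
  Submodule.mem_orthogonal_singleton_iff_inner_right.1 (hCtan u (by simpa using hu) x)

lemma memC.cof_eq (hh : memC n h)
    (hCtan : ∀ u ∈ sphere (0 : E n) 1, ∀ v : E n, Cof u v ∈ (ℝ ∙ u)ᗮ)
    (hCinv : ∀ u ∈ sphere (0 : E n) 1, (sHess h u).comp (Cof u) = sdet h u • tproj u)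
    (hu : ‖u‖ = 1) :
    Cof u = (sHess h u + rankOneSelf u).det •
      (Ring.inverse (sHess h u + rankOneSelf u) * tproj u) :=
  eq_det_smul_inverse_mul_tproj (inner_cof_eq_zero hCtan hu) (hh.sHess_mul_cof hCinv hu)
    (hh.det_ne_zero hu)

lemma memC.cof_apply_self (hh : memC n h)
    (hCtan : ∀ u ∈ sphere (0 : E n) 1, ∀ v : E n, Cof u v ∈ (ℝ ∙ u)ᗮ)
    (hCinv : ∀ u ∈ sphere (0 : E n) 1, (sHess h u).comp (Cof u) = sdet h u • tproj u)
    (hu : ‖u‖ = 1) : Cof u u = 0 := by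
  rw [hh.cof_eq hCtan hCinv hu]
  simp [tproj_apply, hu]

lemma memC.inner_cof_symm (hh : memC n h)
    (hCtan : ∀ u ∈ sphere (0 : E n) 1, ∀ v : E n, Cof u v ∈ (ℝ ∙ u)ᗮ)
    (hCinv : ∀ u ∈ sphere (0 : E n) 1, (sHess h u).comp (Cof u) = sdet h u • tproj u)
    (hu : ‖u‖ = 1) (x y : E n) : ⟪Cof u x, y⟫ = ⟪x, Cof u y⟫ := by
  have hu0 : u ≠ 0 := norm_ne_zero_iff.1 (by simp [hu])
  have hAC : ∀ z, sHess h u (Cof u z) = (sHess h u + rankOneSelf u).det • tproj u z := fun z =>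
    congr($(hh.sHess_mul_cof hCinv hu) z)
  have hC := inner_cof_eq_zero hCtan hu
  have hC' : ∀ z, ⟪Cof u z, u⟫ = 0 := fun z => by rw [real_inner_comm, hC]
  have key := hh.inner_sHess_symm hu0 (Cof u x) (Cof u y)
  rw [hAC, hAC, inner_smul_left, inner_smul_right] at key
  have := mul_left_cancel₀ (hh.det_ne_zero hu) key
  simpa [tproj_apply, inner_sub_left, inner_sub_right, inner_smul_left, inner_smul_right, hC, hC']
    using this.symm

lemma memC.continuous_sHess_add_rankOneSelf (hh : memC n h) :
    Continuous fun u : sphere (0 : E n) 1 => sHess h u + rankOneSelf (u : E n) := by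
  have h1 : Continuous fun u : sphere (0 : E n) 1 => sHess h u :=
    hh.continuousOn_sHess.comp_continuous continuous_subtype_val fun u => by
      have := ne_zero_of_mem_unit_sphere u
      simpa using this
  have h2 : Continuous fun u : sphere (0 : E n) 1 => rankOneSelf (u : E n) := by
    unfold rankOneSelf
    fun_prop
  exact h1.add h2

lemma memC.continuous_sdet (hh : memC n h) :
    Continuous fun u : sphere (0 : E n) 1 => sdet h u := by
  have : (fun u : sphere (0 : E n) 1 => sdet h u)
      = fun u : sphere (0 : E n) 1 => (sHess h u + rankOneSelf (u : E n)).det :=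
    funext fun u => hh.sdet_eq (by simp)
  rw [this]
  exact ContinuousLinearMap.continuous_det.comp hh.continuous_sHess_add_rankOneSelf

lemma memC.continuous_cof (hh : memC n h)
    (hCtan : ∀ u ∈ sphere (0 : E n) 1, ∀ v : E n, Cof u v ∈ (ℝ ∙ u)ᗮ)
    (hCinv : ∀ u ∈ sphere (0 : E n) 1, (sHess h u).comp (Cof u) = sdet h u • tproj u) :
    Continuous fun u : sphere (0 : E n) 1 => Cof u := by
  have : (fun u : sphere (0 : E n) 1 => Cof u)
      = fun u : sphere (0 : E n) 1 => (sHess h u + rankOneSelf (u : E n)).det •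
        (Ring.inverse (sHess h u + rankOneSelf (u : E n)) * tproj (u : E n)) :=
    funext fun u => hh.cof_eq hCtan hCinv (by simp)
  rw [this]
  have hK := hh.continuous_sHess_add_rankOneSelf
  have hinv : Continuous fun u : sphere (0 : E n) 1 =>
      Ring.inverse (sHess h u + rankOneSelf (u : E n)) := by
    refine continuous_iff_continuousAt.2 fun u => ?_
    obtain ⟨U, hU⟩ := isUnit_of_det_ne_zero (hh.det_ne_zero (u := u) (by simp))
    have h1 : ContinuousAt Ring.inverse (sHess h u + rankOneSelf (u : E n)) := by
      rw [← hU]; exact NormedRing.inverse_continuousAt U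
    exact ContinuousAt.comp (f := fun u : sphere (0 : E n) 1 => sHess h u + rankOneSelf (u : E n))
      h1 hK.continuousAt
  have hP : Continuous fun u : sphere (0 : E n) 1 => tproj (u : E n) := by
    unfold tproj
    fun_prop
  exact (ContinuousLinearMap.continuous_det.comp hK).smul (hinv.mul hP)

end Cofactor

lemma hasFDerivAt_norm_of_ne_zero {n : ℕ} {x : E n} (hx : x ≠ 0) :
    HasFDerivAt (fun y : E n => ‖y‖) (‖x‖⁻¹ • innerSL ℝ x) x := by
  have h1 := (hasFDerivAt_id x).norm_sq.sqrt (by simpa using hx)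
  simp only [id, Real.sqrt_sq (norm_nonneg _)] at h1
  refine h1.congr_fderiv ?_
  ext1 v
  simp
  ring

/-- A vector field that is `C¹` away from the origin, cut off by a bump function of the norm
supported away from the origin. -/
lemma contDiff_bump_norm_smul {n : ℕ} {F : Type*} [NormedAddCommGroup F] [NormedSpace ℝ F]
    {c : ℝ} (b : ContDiffBump c) (hb : b.rOut < c) {G : E n → F}
    (hG : ContDiffOn ℝ 1 G {(0 : E n)}ᶜ) : ContDiff ℝ 1 fun x => b ‖x‖ • G x := by
  refine contDiff_iff_contDiffAt.2 fun x => ?_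
  rcases eq_or_ne x 0 with rfl | hx
  · refine (contDiffAt_const (c := (0 : F))).congr_of_eventuallyEq ?_
    filter_upwards [ball_mem_nhds (0 : E n) (sub_pos.2 hb)] with y hy
    rw [mem_ball_zero_iff] at hy
    rw [b.zero_of_le_dist, zero_smul]
    rw [Real.dist_eq, abs_sub_comm]
    exact le_trans (by linarith) (le_abs_self _)
  · exact (b.contDiffAt.comp x (contDiffAt_norm ℝ hx)).smul
      (hG.contDiffAt (isOpen_compl_singleton.mem_nhds hx))

lemma hasCompactSupport_bump_norm_smul {n : ℕ} {F : Type*} [NormedAddCommGroup F]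
    [NormedSpace ℝ F] {c : ℝ} (b : ContDiffBump c) (G : E n → F) :
    HasCompactSupport fun x => b ‖x‖ • G x := by
  refine HasCompactSupport.intro (isCompact_closedBall (0 : E n) (c + b.rOut)) fun x hx => ?_
  rw [mem_closedBall_zero_iff, not_le] at hx
  rw [b.zero_of_le_dist, zero_smul]
  rw [Real.dist_eq]
  exact le_trans (by linarith) (le_abs_self _)

lemma trace_mul_comm_clm {n : ℕ} (M N : E n →L[ℝ] E n) :
    LinearMap.trace ℝ (E n) ((M * N : E n →L[ℝ] E n) : E n →ₗ[ℝ] E n)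
      = LinearMap.trace ℝ (E n) ((N * M : E n →L[ℝ] E n) : E n →ₗ[ℝ] E n) :=
  LinearMap.trace_mul_comm ℝ (M : E n →ₗ[ℝ] E n) (N : E n →ₗ[ℝ] E n)

/-- The trace against an operator with range in `uᗮ` only sees the restriction to `uᗮ`. -/
lemma trace_mul_congr_of_inner_eq_zero {n : ℕ} {u : E n} {C B B' : E n →L[ℝ] E n}
    (hC : ∀ x, ⟪u, C x⟫ = 0) (hB : ∀ v, ⟪u, v⟫ = 0 → B v = B' v) :
    LinearMap.trace ℝ (E n) ((C * B : E n →L[ℝ] E n) : E n →ₗ[ℝ] E n)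
      = LinearMap.trace ℝ (E n) ((C * B' : E n →L[ℝ] E n) : E n →ₗ[ℝ] E n) := by
  rw [trace_mul_comm_clm, trace_mul_comm_clm C]
  congr 2
  ext1 x
  exact hB _ (hC x)

/-- The derivative of a homogeneous tangential field, cut off radially. -/
lemma fderiv_bump_norm_smul_apply {n : ℕ} {V : E n → E n}
    (hV0 : ∀ t : ℝ, 0 < t → ∀ x, V (t • x) = V x) {c : ℝ} (b : ContDiffBump c)
    {u : E n} (hu : ‖u‖ = 1) (hd : DifferentiableAt ℝ V u) {r : ℝ} (hr : 0 < r) (v : E n) :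
    fderiv ℝ (fun y => b ‖y‖ • V y) (r • u) v
      = (b r * r⁻¹) • fderiv ℝ V u v + (deriv b r * ⟪u, v⟫) • V u := by
  have hu0 : u ≠ 0 := norm_ne_zero_iff.1 (by simp [hu])
  have hx0 : r • u ≠ 0 := smul_ne_zero hr.ne' hu0
  have hnorm : ‖r • u‖ = r := by rw [norm_smul, hu, mul_one, Real.norm_of_nonneg hr.le]
  have hdV : DifferentiableAt ℝ V (r • u) := by
    have h1 : V = fun y => V (r⁻¹ • y) := funext fun y => (hV0 _ (inv_pos.2 hr) y).symm
    rw [h1]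
    refine DifferentiableAt.comp (r • u) (g := V) ?_ (by fun_prop)
    rwa [inv_smul_smul₀ hr.ne']
  have hb : HasDerivAt b (deriv b r) ‖r • u‖ := by
    rw [hnorm]
    exact ((b.contDiff (n := 1)).differentiable one_ne_zero r).hasDerivAt
  have h1 := (hb.comp_hasFDerivAt (r • u) (hasFDerivAt_norm_of_ne_zero hx0)).smul hdV.hasFDerivAt
  have h2 : fderiv ℝ V (r • u) = r⁻¹ • fderiv ℝ V u := by
    rw [← smul_fderiv_smul_of_homogeneous hV0 hr u, inv_smul_smul₀ hr.ne']
  have h3 := congr($(h1.fderiv) v)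
  simp only [Function.comp_apply] at h3
  change fderiv ℝ (fun y => b ‖y‖ • V y) (r • u) v = _ at h3
  rw [h3, h2]
  simp [hnorm, hV0 r hr, smul_smul, hr.ne']

lemma hasCompactSupport_add_const_smul {n : ℕ} {f g : E n → E n} (hf : HasCompactSupport f)
    (hg : HasCompactSupport g) (c : ℝ) : HasCompactSupport fun x => f x + c • g x := by
  refine HasCompactSupport.intro (hf.isCompact.union hg.isCompact) fun x hx => ?_
  rw [Set.mem_union, not_or] at hx
  rw [image_eq_zero_of_notMem_tsupport hx.1, image_eq_zero_of_notMem_tsupport hx.2, smul_zero,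
    add_zero]

lemma smul_zero_clm {n : ℕ} (c : ℝ) : c • (0 : E n →L[ℝ] E n) = 0 := by
  ext1 x; simp

lemma memC.det_inv_smul_sHess_add {n : ℕ} {h : E n → ℝ} (hn : n ≠ 0) (hh : memC n h) {u : E n}
    (hu : ‖u‖ = 1) {r : ℝ} (hr : 0 < r) :
    (r⁻¹ • sHess h u + rankOneSelf u).det
      = (r ^ (n - 1))⁻¹ * (sHess h u + rankOneSelf u).det := by
  have hpow : r⁻¹ ^ n * r = (r ^ (n - 1))⁻¹ := by
    obtain ⟨m, rfl⟩ := Nat.exists_eq_succ_of_ne_zero hn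
    simp [pow_succ, hr.ne']
  have h1 : r⁻¹ • sHess h u + rankOneSelf u
      = (r⁻¹ • (tproj u + r • rankOneSelf u)) * (sHess h u + rankOneSelf u) := by
    ext1 x
    simp [tproj_apply, rankOneSelf_apply, inner_add_right, inner_smul_right,
      hh.inner_sHess_eq_zero hu, hu, hr.ne']
  rw [h1, det_mul_clm, det_smul_clm, det_tproj_add_smul_rankOneSelf hu, hpow]

/-- A combination of mixed Jacobian integrals of compactly supported fields vanishes. -/
lemma integral_sum_det_fderiv_eq_zero {n : ℕ} (hn : n ≠ 0) {ι : Type*} [Fintype ι] (w : ι → ℝ)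
    {Y : ι → ι → E n → E n} (hY : ∀ i j, ContDiff ℝ 1 (Y i j))
    (hYc : ∀ i j, HasCompactSupport (Y i j)) :
    ∫ x, ∑ i, w i * ∑ j, w j * (fderiv ℝ (Y i j) x).det = 0 := by
  have hdet0 : (0 : E n →L[ℝ] E n).det = 0 := by
    have := det_smul_clm (n := n) 0 0
    rwa [zero_pow hn, zero_mul, smul_zero_clm] at this
  have hYint : ∀ i j, Integrable (fun x => (fderiv ℝ (Y i j) x).det) := fun i j =>
    (ContinuousLinearMap.continuous_det.comp
      ((hY i j).continuous_fderiv one_ne_zero)).integrable_of_hasCompactSupport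
      (((hYc i j).fderiv ℝ).comp_left (g := ContinuousLinearMap.det) hdet0)
  rw [integral_finsetSum _ fun i _ =>
    (integrable_finsetSum _ fun j _ => (hYint i j).const_mul _).const_mul _]
  refine Finset.sum_eq_zero fun i _ => ?_
  rw [integral_const_mul, integral_finsetSum _ fun j _ => (hYint i j).const_mul _]
  simp only [integral_const_mul, integral_det_fderiv_eq_zero hn (hY i _) (hYc i _), mul_zero,
    Finset.sum_const_zero]

section
variable {n : ℕ} {h : E n → ℝ} {V : E n → E n} {Cof : E n → E n →L[ℝ] E n} {v w : Fin (n + 1) → ℝ}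

/-- The weighted sum of Jacobians at a point where the outer cutoff is locally constant. -/
lemma sum_det_eq_trace (hn : n ≠ 0) (hh : memC n h)
    (hCtan : ∀ u ∈ sphere (0 : E n) 1, ∀ v : E n, Cof u v ∈ (ℝ ∙ u)ᗮ)
    (hCinv : ∀ u ∈ sphere (0 : E n) 1, (sHess h u).comp (Cof u) = sdet h u • tproj u)
    (hV : ContDiffOn ℝ 1 V {(0 : E n)}ᶜ) (hV0 : ∀ t : ℝ, 0 < t → ∀ x, V (t • x) = V x)
    (hVT : ∀ x, ⟪x, V x⟫ = 0)
    (hw : ∀ p : Polynomial ℝ, p.natDegree ≤ n → p.coeff 1 = ∑ i, w i * p.eval (v i))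
    {c : ℝ} (b : ContDiffBump c) {u : E n} (hu : ‖u‖ = 1) {r : ℝ} (hr : 0 < r) :
    ∑ i, w i * ∑ j, w j * (sHess h (r • u) + v i • (1 : E n →L[ℝ] E n)
        + v j • fderiv ℝ (fun y => b ‖y‖ • V y) (r • u)).det
      = LinearMap.trace ℝ (E n) ((Cof u * fderiv ℝ V u : E n →L[ℝ] E n) : E n →ₗ[ℝ] E n)
        * (b r * (r ^ (n - 1))⁻¹) := by
  have hu0 : u ≠ 0 := norm_ne_zero_iff.1 (by simp [hu])
  have hd : DifferentiableAt ℝ V u :=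
    (hV.contDiffAt (isOpen_compl_singleton.mem_nhds hu0)).differentiableAt one_ne_zero
  have hAu := hh.sHess_apply_self hu0
  have hRA : ∀ x, ⟪u, sHess h u x⟫ = 0 := hh.inner_sHess_eq_zero hu
  have hC := inner_cof_eq_zero hCtan hu
  have hAdet := hh.det_inv_smul_sHess_add hn hu hr
  set c' : ℝ := r * (r ^ (n - 1))⁻¹ with hc'
  have hB := fderiv_bump_norm_smul_apply hV0 b hu hd hr
  rw [hh.sHess_smul hr, mixed_coeff_det hw hu (C := c' • Cof u)]
  · have h1 : LinearMap.trace ℝ (E n) (((c' • Cof u) *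
        fderiv ℝ (fun y => b ‖y‖ • V y) (r • u) : E n →L[ℝ] E n) : E n →ₗ[ℝ] E n)
        = LinearMap.trace ℝ (E n) (((c' • Cof u) * ((b r * r⁻¹) • fderiv ℝ V u)
          : E n →L[ℝ] E n) : E n →ₗ[ℝ] E n) := by
      refine trace_mul_congr_of_inner_eq_zero (u := u) (fun x => ?_) fun x hx => ?_
      · simp [inner_smul_right, hC]
      · rw [hB, hx]; simp
    have h2 : (c' • Cof u) * ((b r * r⁻¹) • fderiv ℝ V u)
        = (c' * (b r * r⁻¹)) • (Cof u * fderiv ℝ V u) := by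
      ext1 x
      simp [smul_smul, mul_comm]
    rw [h1, h2, trace_smul_clm, hc']
    field_simp
  · simp [hAu]
  · intro x; simp [inner_smul_right, hRA]
  · rw [hB, fderiv_apply_self_of_homogeneous hV0 hd]
    simp [inner_smul_right, hVT]
  · intro x; simp [inner_smul_right, hC]
  · rw [hAdet]
    ext1 x
    have h1 : sHess h u (Cof u x) = (sHess h u + rankOneSelf u).det • tproj u x :=
      congr($(hh.sHess_mul_cof hCinv hu) x)
    change r⁻¹ • sHess h u (c' • Cof u x)
      = ((r ^ (n - 1))⁻¹ * (sHess h u + rankOneSelf u).det) • tproj u x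
    rw [map_smul, h1, smul_smul, smul_smul, hc', inv_mul_cancel_left₀ hr.ne']
  · rw [hAdet]
    exact mul_ne_zero (inv_ne_zero (pow_ne_zero _ hr.ne')) (hh.det_ne_zero hu)

open Filter Topology in
/-- The weighted sum of Jacobians of the cut-off fields. -/
lemma sum_det_fderiv_eq_trace (hn : n ≠ 0) (hh : memC n h)
    (hCtan : ∀ u ∈ sphere (0 : E n) 1, ∀ v : E n, Cof u v ∈ (ℝ ∙ u)ᗮ)
    (hCinv : ∀ u ∈ sphere (0 : E n) 1, (sHess h u).comp (Cof u) = sdet h u • tproj u)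
    (hV : ContDiffOn ℝ 1 V {(0 : E n)}ᶜ) (hV0 : ∀ t : ℝ, 0 < t → ∀ x, V (t • x) = V x)
    (hVT : ∀ x, ⟪x, V x⟫ = 0)
    (hw : ∀ p : Polynomial ℝ, p.natDegree ≤ n → p.coeff 1 = ∑ i, w i * p.eval (v i))
    {c : ℝ} {b χ : ContDiffBump c} (hbχ : b.rOut < χ.rIn) (hχ : χ.rOut < c)
    {u : E n} (hu : ‖u‖ = 1) {r : ℝ} (hr : 0 < r) :
    ∑ i, w i * ∑ j, w j * (fderiv ℝ (fun x => χ ‖x‖ • (gradient h x + v i • x)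
        + v j • (b ‖x‖ • V x)) (r • u)).det
      = LinearMap.trace ℝ (E n) ((Cof u * fderiv ℝ V u : E n →L[ℝ] E n) : E n →ₗ[ℝ] E n)
        * (b r * (r ^ (n - 1))⁻¹) := by
  have hb : b.rOut < c := hbχ.trans (χ.rIn_lt_rOut.trans hχ)
  have hw0 : ∑ i, w i = 0 := by
    have := hw 1 (by simp)
    simpa [Polynomial.coeff_one] using this.symm
  have hnorm : ‖r • u‖ = r := by rw [norm_smul, hu, mul_one, Real.norm_of_nonneg hr.le]
  have hx0 : r • u ≠ 0 := norm_ne_zero_iff.1 (by rw [hnorm]; exact hr.ne')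
  have hfd : ∀ i j, fderiv ℝ (fun x => χ ‖x‖ • (gradient h x + v i • x)
      + v j • (b ‖x‖ • V x)) (r • u)
      = fderiv ℝ (fun x => χ ‖x‖ • (gradient h x + v i • x)) (r • u)
        + v j • fderiv ℝ (fun x => b ‖x‖ • V x) (r • u) := fun i j => by
    have h1 : ContDiff ℝ 1 fun x => χ ‖x‖ • (gradient h x + v i • x) :=
      contDiff_bump_norm_smul χ hχ (hh.contDiffOn_gradient.add (by fun_prop))
    have h2 := (contDiff_bump_norm_smul b hb hV).differentiable one_ne_zero (r • u)
    exact ((h1.differentiable one_ne_zero (r • u)).hasFDerivAt.add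
      (h2.hasFDerivAt.const_smul (v j))).fderiv
  have hcont : Tendsto (fun x : E n => ‖x‖) (𝓝 (r • u)) (𝓝 r) := by
    simpa [hnorm] using (continuous_norm (E := E n)).tendsto (r • u)
  rcases lt_or_ge (dist r c) χ.rIn with hrc | hrc
  · have h1 : ∀ i, fderiv ℝ (fun x => χ ‖x‖ • (gradient h x + v i • x)) (r • u)
        = sHess h (r • u) + v i • (1 : E n →L[ℝ] E n) := fun i => by
      have hev : (fun x => χ ‖x‖ • (gradient h x + v i • x))
          =ᶠ[𝓝 (r • u)] fun x => gradient h x + v i • x := by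
        filter_upwards [hcont.eventually (χ.eventuallyEq_one_of_mem_ball hrc)] with x hx
        rw [hx, Pi.one_apply, one_smul]
      rw [hev.fderiv_eq]
      exact ((hh.differentiableAt_gradient hx0).hasFDerivAt.add
        ((hasFDerivAt_id (r • u)).const_smul (v i))).fderiv
    simp only [hfd, h1]
    exact sum_det_eq_trace hn hh hCtan hCinv hV hV0 hVT hw b hu hr
  · have hev : (fun x => b ‖x‖ • V x) =ᶠ[𝓝 (r • u)] fun _ => 0 := by
      have : ∀ᶠ s in 𝓝 r, b.rOut < dist s c :=
        (isOpen_lt continuous_const (by fun_prop)).mem_nhds (hbχ.trans_le hrc)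
      filter_upwards [hcont.eventually this] with x hx
      rw [b.zero_of_le_dist hx.le, zero_smul]
    have hbr : b r = 0 := b.zero_of_le_dist (hbχ.le.trans hrc)
    have h0 : fderiv ℝ (fun x => b ‖x‖ • V x) (r • u) = 0 := by
      rw [hev.fderiv_eq, fderiv_fun_const]; rfl
    simp only [hfd, h0, hbr, smul_zero_clm, add_zero, ← Finset.sum_mul, hw0, zero_mul, mul_zero,
      Finset.sum_const_zero]

/-- The divergence-type identity `∫ tr (Cof ∘ ∇V) = 0` for tangential fields on the sphere. -/
theorem integral_trace_cof_mul_fderiv_eq_zero (hn : n ≠ 0) (hh : memC n h)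
    (hCtan : ∀ u ∈ sphere (0 : E n) 1, ∀ v : E n, Cof u v ∈ (ℝ ∙ u)ᗮ)
    (hCinv : ∀ u ∈ sphere (0 : E n) 1, (sHess h u).comp (Cof u) = sdet h u • tproj u)
    (hV : ContDiffOn ℝ 1 V {(0 : E n)}ᶜ) (hV0 : ∀ t : ℝ, 0 < t → ∀ x, V (t • x) = V x)
    (hVT : ∀ x, ⟪x, V x⟫ = 0) :
    ∫ u : sphere (0 : E n) 1, LinearMap.trace ℝ (E n)
      ((Cof u * fderiv ℝ V u : E n →L[ℝ] E n) : E n →ₗ[ℝ] E n)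
        ∂(volume : Measure (E n)).toSphere = 0 := by
  obtain ⟨v, hv⟩ : ∃ v : Fin (n + 1) → ℝ, Function.Injective v :=
    ⟨fun i => (i : ℕ), fun i j hij => Fin.ext (Nat.cast_injective hij)⟩
  obtain ⟨w, hw⟩ := exists_coeff_weights v hv 1
  obtain ⟨b, hb⟩ : ∃ b : ContDiffBump (3 : ℝ), b.rOut = 1 :=
    ⟨⟨1 / 2, 1, by norm_num, by norm_num⟩, rfl⟩
  obtain ⟨χ, hχI, hχO⟩ : ∃ χ : ContDiffBump (3 : ℝ), χ.rIn = 3 / 2 ∧ χ.rOut = 2 :=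
    ⟨⟨3 / 2, 2, by norm_num, by norm_num⟩, rfl, rfl⟩
  have hχ : χ.rOut < 3 := by rw [hχO]; norm_num
  have hb3 : b.rOut < 3 := by rw [hb]; norm_num
  have hY : ∀ i j, ContDiff ℝ 1 fun x => χ ‖x‖ • (gradient h x + v i • x) + v j • (b ‖x‖ • V x) :=
    fun i j => (contDiff_bump_norm_smul χ hχ (hh.contDiffOn_gradient.add (by fun_prop))).add
      ((contDiff_bump_norm_smul b hb3 hV).const_smul (v j))
  have hYc : ∀ i j, HasCompactSupport
      fun x => χ ‖x‖ • (gradient h x + v i • x) + v j • (b ‖x‖ • V x) :=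
    fun i j => hasCompactSupport_add_const_smul (hasCompactSupport_bump_norm_smul χ _)
      (hasCompactSupport_bump_norm_smul b V) (v j)
  have hzero := integral_sum_det_fderiv_eq_zero hn w hY hYc
  have hpolar := fun (u : sphere (0 : E n) 1) (r : ℝ) (hr : 0 < r) =>
    sum_det_fderiv_eq_trace hn hh hCtan hCinv hV hV0 hVT hw
      (b := b) (χ := χ) (by rw [hb, hχI]; norm_num) hχ (u := u) (by simp) hr
  rw [integral_eq_toSphere_mul hn hpolar] at hzero
  refine (mul_eq_zero.1 hzero).resolve_right (ne_of_gt ?_)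
  have h1 : ∫ r in Set.Ioi (0 : ℝ), r ^ (n - 1) * (b r * (r ^ (n - 1))⁻¹) = ∫ r, b r := by
    rw [setIntegral_congr_fun (g := b) measurableSet_Ioi fun r hr => ?_]
    · refine setIntegral_eq_integral_of_forall_compl_eq_zero fun r hr => ?_
      refine b.zero_of_le_dist ?_
      rw [Set.mem_Ioi, not_lt] at hr
      rw [Real.dist_eq, abs_sub_comm, hb]
      exact le_trans (by linarith) (le_abs_self _)
    · have : r ≠ 0 := ne_of_gt hr
      field_simp
  rw [h1]
  exact b.integral_pos
end

lemma contDiffOn_inv_norm {n : ℕ} : ContDiffOn ℝ 1 (fun x : E n => ‖x‖⁻¹) {(0 : E n)}ᶜ :=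
  fun _ hx => ((contDiffAt_norm ℝ hx).inv (norm_ne_zero_iff.2 hx)).contDiffWithinAt

lemma hasFDerivAt_inv_norm {n : ℕ} {u : E n} (hu : ‖u‖ = 1) :
    HasFDerivAt (fun x : E n => ‖x‖⁻¹) (-innerSL ℝ u) u := by
  have hu0 : u ≠ 0 := norm_ne_zero_iff.1 (by simp [hu])
  refine ((hasDerivAt_inv (norm_ne_zero_iff.2 hu0)).comp_hasFDerivAt u
    (hasFDerivAt_norm_of_ne_zero hu0)).congr_fderiv ?_
  ext1 v
  simp [hu]

lemma trace_mul_smulRight {n : ℕ} (C : E n →L[ℝ] E n) (f : E n →L[ℝ] ℝ) (x : E n) :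
    LinearMap.trace ℝ (E n) ((C * f.smulRight x : E n →L[ℝ] E n) : E n →ₗ[ℝ] E n) = f (C x) := by
  rw [← trace_smulRight_clm]
  congr 2
  ext1 y
  simp

lemma trace_tproj {n : ℕ} {u : E n} (hu : ‖u‖ = 1) :
    LinearMap.trace ℝ (E n) (tproj u : E n →ₗ[ℝ] E n) = n - 1 := by
  have h : tproj u = 1 + (-1 : ℝ) • (innerSL ℝ u).smulRight u := by
    ext1 x
    simp [tproj_apply, sub_eq_add_neg]
  have h1 : LinearMap.trace ℝ (E n) ((1 : E n →L[ℝ] E n) : E n →ₗ[ℝ] E n) = n := by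
    have := LinearMap.trace_one ℝ (E n)
    rwa [finrank_euclideanSpace_fin] at this
  rw [h, trace_add_clm, trace_smul_clm, trace_smulRight_clm, h1]
  simp [hu]
  ring

section
variable {n : ℕ} {h : E n → ℝ} {Cof : E n → E n →L[ℝ] E n}

lemma integral_inner_mul_sdet_eq_zero (hn : 2 ≤ n) (hh : memC n h)
    (hCtan : ∀ u ∈ sphere (0 : E n) 1, ∀ v : E n, Cof u v ∈ (ℝ ∙ u)ᗮ)
    (hCinv : ∀ u ∈ sphere (0 : E n) 1, (sHess h u).comp (Cof u) = sdet h u • tproj u) (a : E n) :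
    ∫ u : sphere (0 : E n) 1, ⟪(u : E n), a⟫ * sdet h u ∂(volume : Measure (E n)).toSphere = 0 := by
  let V : E n → E n := fun x => (⟪x, a⟫ * ‖x‖⁻¹) • gradient h x - (‖x‖⁻¹ * h x) • a
  have hV : ContDiffOn ℝ 1 V {(0 : E n)}ᶜ := by
    have h1 : ContDiffOn ℝ 1 (fun x : E n => ⟪x, a⟫) {(0 : E n)}ᶜ :=
      contDiffOn_id.inner ℝ contDiffOn_const
    exact ((h1.mul contDiffOn_inv_norm).smul hh.contDiffOn_gradient).sub
      ((contDiffOn_inv_norm.mul (hh.2.1.of_le (by norm_num))).smul contDiffOn_const)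
  have hV0 : ∀ t : ℝ, 0 < t → ∀ x, V (t • x) = V x := fun t ht x => by
    have h1 : ⟪t • x, a⟫ * ‖t • x‖⁻¹ = ⟪x, a⟫ * ‖x‖⁻¹ := by
      rw [norm_smul, Real.norm_of_nonneg ht.le, real_inner_smul_left]
      field_simp
    have h2 : ‖t • x‖⁻¹ * h (t • x) = ‖x‖⁻¹ * h x := by
      rw [norm_smul, Real.norm_of_nonneg ht.le, hh.1 t ht]
      field_simp
    simp only [V, h1, h2, hh.gradient_smul t ht]
  have hVT : ∀ x, ⟪x, V x⟫ = 0 := fun x => by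
    rcases eq_or_ne x 0 with rfl | hx
    · exact inner_zero_left _
    · simp only [V, inner_sub_right, real_inner_smul_right]
      rw [real_inner_comm (gradient h x) x, hh.inner_gradient_self hx]
      ring
  have key : ∀ u : sphere (0 : E n) 1,
      LinearMap.trace ℝ (E n) ((Cof u * fderiv ℝ V u : E n →L[ℝ] E n) : E n →ₗ[ℝ] E n)
        = (n - 1) * (⟪(u : E n), a⟫ * sdet h u) := by
    rintro ⟨u, hu⟩
    replace hu : ‖u‖ = 1 := by simpa using hu
    have hu0 : u ≠ 0 := norm_ne_zero_iff.1 (by simp [hu])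
    have h1 : HasFDerivAt (fun x : E n => ⟪x, a⟫) (innerSL ℝ a) u :=
      ((innerSL ℝ a).hasFDerivAt (x := u)).congr_of_eventuallyEq
        (Filter.Eventually.of_forall fun x => real_inner_comm _ _)
    have h2 := ((h1.mul (hasFDerivAt_inv_norm hu)).smul
      (hh.differentiableAt_gradient hu0).hasFDerivAt).sub
      (((hasFDerivAt_inv_norm hu).mul (hh.differentiableAt hu0).hasFDerivAt).smul_const a)
    have hfd : ∀ v, ⟪u, v⟫ = 0 → fderiv ℝ V u v = ((innerSL ℝ a).smulRight (gradient h u)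
        + ⟪u, a⟫ • sHess h u + (-1 : ℝ) • (innerSL ℝ (gradient h u)).smulRight a) v := by
      intro v hv
      have h3 : fderiv ℝ V u v = _ := congr($(h2.fderiv) v)
      rw [h3]
      simp [hv, hu, sHess, inner_gradient_left]
      module
    have hsplit : Cof u * ((innerSL ℝ a).smulRight (gradient h u)
        + ⟪u, a⟫ • sHess h u + (-1 : ℝ) • (innerSL ℝ (gradient h u)).smulRight a)
        = Cof u * (innerSL ℝ a).smulRight (gradient h u) + ⟪u, a⟫ • (Cof u * sHess h u)
          + (-1 : ℝ) • (Cof u * (innerSL ℝ (gradient h u)).smulRight a) := by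
      ext1 x
      simp
    change LinearMap.trace ℝ (E n) ((Cof u * fderiv ℝ V u : E n →L[ℝ] E n) : E n →ₗ[ℝ] E n)
        = (n - 1) * (⟪u, a⟫ * sdet h u)
    rw [trace_mul_congr_of_inner_eq_zero (inner_cof_eq_zero hCtan hu) hfd, hsplit, trace_add_clm,
      trace_add_clm, trace_smul_clm, trace_smul_clm, trace_mul_smulRight, trace_mul_smulRight,
      trace_mul_comm_clm, hh.sHess_mul_cof hCinv hu, ← hh.sdet_eq hu, trace_smul_clm,
      trace_tproj hu]
    simp only [innerSL_apply_apply]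
    rw [← hh.inner_cof_symm hCtan hCinv hu, real_inner_comm]
    ring
  have hmain := integral_trace_cof_mul_fderiv_eq_zero (by omega) hh hCtan hCinv hV hV0 hVT
  simp only [key, integral_const_mul] at hmain
  have hn' : (2 : ℝ) ≤ n := by exact_mod_cast hn
  exact (mul_eq_zero.1 hmain).resolve_left (by linarith)

lemma integral_trace_cof_sub_eq_zero (hn : n ≠ 0) (hh : memC n h)
    (hCtan : ∀ u ∈ sphere (0 : E n) 1, ∀ v : E n, Cof u v ∈ (ℝ ∙ u)ᗮ)
    (hCinv : ∀ u ∈ sphere (0 : E n) 1, (sHess h u).comp (Cof u) = sdet h u • tproj u) (a : E n) :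
    ∫ u : sphere (0 : E n) 1, (LinearMap.trace ℝ (E n) (Cof u : E n →ₗ[ℝ] E n) * ⟪(u : E n), a⟫ ^ 2
      - ⟪Cof u (tproj (u : E n) a), tproj (u : E n) a⟫) ∂(volume : Measure (E n)).toSphere = 0 := by
  let V : E n → E n := fun x => (⟪x, a⟫ * ‖x‖⁻¹) • (a - (⟪x, a⟫ * ‖x‖⁻¹) • (‖x‖⁻¹ • x))
  have hV : ContDiffOn ℝ 1 V {(0 : E n)}ᶜ := by
    have h1 : ContDiffOn ℝ 1 (fun x : E n => ⟪x, a⟫) {(0 : E n)}ᶜ :=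
      contDiffOn_id.inner ℝ contDiffOn_const
    have h2 := h1.mul contDiffOn_inv_norm
    exact h2.smul (contDiffOn_const.sub (h2.smul (contDiffOn_inv_norm.smul contDiffOn_id)))
  have hV0 : ∀ t : ℝ, 0 < t → ∀ x, V (t • x) = V x := fun t ht x => by
    have h1 : ⟪t • x, a⟫ * ‖t • x‖⁻¹ = ⟪x, a⟫ * ‖x‖⁻¹ := by
      rw [norm_smul, Real.norm_of_nonneg ht.le, real_inner_smul_left]
      field_simp
    have h2 : ‖t • x‖⁻¹ • t • x = ‖x‖⁻¹ • x := by
      rw [norm_smul, Real.norm_of_nonneg ht.le, smul_smul]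
      congr 1
      field_simp
    simp only [V, h1, h2]
  have hVT : ∀ x, ⟪x, V x⟫ = 0 := fun x => by
    rcases eq_or_ne x 0 with rfl | hx
    · exact inner_zero_left _
    · have : ‖x‖ ≠ 0 := norm_ne_zero_iff.2 hx
      simp only [V, inner_sub_right, real_inner_smul_right, real_inner_self_eq_norm_sq]
      field_simp
      ring
  have key : ∀ u : sphere (0 : E n) 1,
      LinearMap.trace ℝ (E n) ((Cof u * fderiv ℝ V u : E n →L[ℝ] E n) : E n →ₗ[ℝ] E n)
        = -(LinearMap.trace ℝ (E n) (Cof u : E n →ₗ[ℝ] E n) * ⟪(u : E n), a⟫ ^ 2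
          - ⟪Cof u (tproj (u : E n) a), tproj (u : E n) a⟫) := by
    rintro ⟨u, hu⟩
    replace hu : ‖u‖ = 1 := by simpa using hu
    have h1 : HasFDerivAt (fun x : E n => ⟪x, a⟫) (innerSL ℝ a) u :=
      ((innerSL ℝ a).hasFDerivAt (x := u)).congr_of_eventuallyEq
        (Filter.Eventually.of_forall fun x => real_inner_comm _ _)
    have h2 := h1.mul (hasFDerivAt_inv_norm hu)
    have h3 := h2.smul ((hasFDerivAt_const a u).sub
      (h2.smul ((hasFDerivAt_inv_norm hu).smul (hasFDerivAt_id u))))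
    have hfd : ∀ v, ⟪u, v⟫ = 0 → fderiv ℝ V u v = ((innerSL ℝ a).smulRight (a - (2 * ⟪u, a⟫) • u)
        + (-⟪u, a⟫ ^ 2) • (1 : E n →L[ℝ] E n)) v := fun v hv => by
      have h4 : fderiv ℝ V u v = _ := congr($(h3.fderiv) v)
      rw [h4]
      simp [hv, hu]
      module
    have hsplit : Cof u * ((innerSL ℝ a).smulRight (a - (2 * ⟪u, a⟫) • u)
        + (-⟪u, a⟫ ^ 2) • (1 : E n →L[ℝ] E n))
        = Cof u * (innerSL ℝ a).smulRight (a - (2 * ⟪u, a⟫) • u) + (-⟪u, a⟫ ^ 2) • Cof u := by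
      ext1 x
      simp
    change LinearMap.trace ℝ (E n) ((Cof u * fderiv ℝ V u : E n →L[ℝ] E n) : E n →ₗ[ℝ] E n)
        = -(LinearMap.trace ℝ (E n) (Cof u : E n →ₗ[ℝ] E n) * ⟪u, a⟫ ^ 2
          - ⟪Cof u (tproj u a), tproj u a⟫)
    have hCu := hh.cof_apply_self hCtan hCinv hu
    have hC' : ∀ x, ⟪Cof u x, u⟫ = 0 := fun x => by
      rw [real_inner_comm, inner_cof_eq_zero hCtan hu]
    rw [trace_mul_congr_of_inner_eq_zero (inner_cof_eq_zero hCtan hu) hfd, hsplit, trace_add_clm,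
      trace_smul_clm, trace_mul_smulRight]
    simp only [innerSL_apply_apply, tproj_apply, map_sub, map_smul, hCu, smul_zero, sub_zero,
      inner_sub_right, real_inner_smul_right, hC', mul_zero]
    rw [real_inner_comm]
    ring
  have hmain := integral_trace_cof_mul_fderiv_eq_zero hn hh hCtan hCinv hV hV0 hVT
  simp only [key, integral_neg, neg_eq_zero] at hmain
  exact hmain
end

/-- Sharpness of Theorem `T2` (Remark of §3):  Let `h ∈ 𝒞`, let `(c_ij)` be the cofactor
matrix of `(h_ij + h δ_ij)` (represented by the tangent-valued endomorphism field `Cof`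
with `(sHess h u) ∘ (Cof u) = det(h_ij + h δ_ij)(u) • tproj u`), let `u₀ ∈ ℝⁿ` be a
fixed vector, and let `φ(u) = ⟨u, u₀⟩`.  Then
`∫_{S^{n-1}} φ det(h_ij + h δ_ij) dℋ^{n-1} = 0` and
`∫ tr(c_ij) φ² dℋ^{n-1} = ∫ Σ_{i,j} c_ij φ_i φ_j dℋ^{n-1}`,
the latter integrand being `⟨Cof u (∇φ), ∇φ⟩` with `∇φ` the tangential gradient. -/
theorem equality_case_sphere
    {n : ℕ} (hn : 2 ≤ n) (h : E n → ℝ) (hh : memC n h)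
    (Cof : E n → E n →L[ℝ] E n)
    (hCtan : ∀ u ∈ sphere (0 : E n) 1, ∀ v : E n, Cof u v ∈ (ℝ ∙ u)ᗮ)
    (hCinv : ∀ u ∈ sphere (0 : E n) 1, (sHess h u).comp (Cof u) = sdet h u • tproj u)
    (u₀ : E n) (φ : E n → ℝ) (hφdef : ∀ u, φ u = ⟪u, u₀⟫) :
    (∫ u in sphere (0 : E n) 1, φ u * sdet h u ∂μH[(n : ℝ) - 1]) = 0 ∧
    (∫ u in sphere (0 : E n) 1,
        (LinearMap.trace ℝ (E n) ((Cof u : E n →ₗ[ℝ] E n))) * (φ u) ^ 2 ∂μH[(n : ℝ) - 1])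
      = ∫ u in sphere (0 : E n) 1,
          ⟪Cof u (tproj u (gradient φ u)), tproj u (gradient φ u)⟫ ∂μH[(n : ℝ) - 1] := by
  have hd : (0 : ℝ) ≤ (n : ℝ) - 1 := by
    have : (2 : ℝ) ≤ n := by exact_mod_cast hn
    linarith
  have hμ : ∀ G : E n ≃ₗᵢ[ℝ] E n, MeasurePreserving (sphereIsometry G)
      (μH[(n : ℝ) - 1] : Measure (sphere (0 : E n) 1)) μH[(n : ℝ) - 1] :=
    fun G => (sphereIsometry G).measurePreserving_hausdorffMeasure _
  have hgrad : ∀ u, gradient φ u = u₀ := fun u => by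
    refine HasGradientAt.gradient (hasGradientAt_iff_hasFDerivAt.2 ?_)
    exact ((innerSL ℝ u₀).hasFDerivAt (x := u)).congr_of_eventuallyEq
      (Filter.Eventually.of_forall fun x => (hφdef x).trans (real_inner_comm _ _))
  simp only [setIntegral_sphere_hausdorffMeasure hd, hφdef, hgrad]
  have hφ : Continuous fun u : sphere (0 : E n) 1 => ⟪(u : E n), u₀⟫ := by fun_prop
  have hC := hh.continuous_cof hCtan hCinv
  have hP : Continuous fun u : sphere (0 : E n) 1 => tproj (u : E n) u₀ := by
    simp only [tproj_apply]
    fun_prop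
  refine ⟨integral_eq_zero_of_toSphere hμ (hφ.mul hh.continuous_sdet)
      (integral_inner_mul_sdet_eq_zero hn hh hCtan hCinv u₀),
    integral_eq_of_toSphere hμ ((continuous_trace_clm.comp hC).mul (hφ.pow 2))
      ((hC.clm_apply hP).inner hP)
      (integral_trace_cof_sub_eq_zero (by omega) hh hCtan hCinv u₀)⟩
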